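/- Let n be a positive multiple of 8 and let G = Circ[n, {1, n/2 − 1}]. Then for every field F, M(F,G) = Z(G) = n/2 + 2; moreover the adjacency matrix A(G), with entries interpreted in F, has rank n − (n/2 + 2) over every field F, so G has field independent minimum rank and A(G) is a universally optimal matrix. -/

import Mathlib

open scoped Classical

noncomputable section

namespace Paper

variable {V : Type*}

/-- The set of vertices eventually colored blue starting from `Z` under the
zero forcing color change rule. -/
inductive Forced (G : SimpleGraph V) (Z : Set V) : V → Prop
  | init (v : V) : v ∈ Z → Forced G Z v
  | force (u w : V) : Forced G Z u → G.Adj u w →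
      (∀ x, G.Adj u x → x ≠ w → Forced G Z x) → Forced G Z w

/-- `Z` is a zero forcing set of `G`. -/
def IsZeroForcingSet (G : SimpleGraph V) (Z : Set V) : Prop := ∀ v, Forced G Z v

/-- The zero forcing number `Z(G)`. -/
def zfn (G : SimpleGraph V) : ℕ :=
  sInf {m | ∃ Z : Set V, Z.ncard = m ∧ IsZeroForcingSet G Z}

/-- Membership in the set `S(F,G)` of symmetric matrices described by `G`. -/
def SMat (F : Type*) [Field F] (G : SimpleGraph V) (A : Matrix V V F) : Prop :=
  A.IsSymm ∧ ∀ i j : V, i ≠ j → (A i j ≠ 0 ↔ G.Adj i j)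

/-- Maximum nullity `M(F,G)`. -/
def maxNullity (F : Type*) [Field F] [Fintype V] (G : SimpleGraph V) : ℕ :=
  sSup {m | ∃ A : Matrix V V F, SMat F G A ∧ Fintype.card V - A.rank = m}

/-- Minimum rank `mr(F,G)`. -/
def minRank (F : Type*) [Field F] [Fintype V] (G : SimpleGraph V) : ℕ :=
  sInf {m | ∃ A : Matrix V V F, SMat F G A ∧ A.rank = m}

/-- The Strong Arnold Property. -/
def HasSAP [Fintype V] [DecidableEq V] (A : Matrix V V ℝ) : Prop :=
  ∀ X : Matrix V V ℝ, X.IsSymm → A * X = 0 → Matrix.hadamard A X = 0 →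
    Matrix.hadamard (1 : Matrix V V ℝ) X = 0 → X = 0

/-- The Colin de Verdière type parameter `ξ(G)`. -/
def xi [Fintype V] [DecidableEq V] (G : SimpleGraph V) : ℕ :=
  sSup {m | ∃ A : Matrix V V ℝ, SMat ℝ G A ∧ HasSAP A ∧ Fintype.card V - A.rank = m}

/-- The adjacency matrix of `G` with entries in `R`. -/
def adjMat (R : Type*) [Zero R] [One R] (G : SimpleGraph V) : Matrix V V R :=
  Matrix.of fun i j => if G.Adj i j then 1 else 0

/-- Minimum degree `δ(G)`. -/
def minDeg (G : SimpleGraph V) : ℕ :=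
  sInf {d | ∃ v : V, (G.neighborSet v).ncard = d}

/-- Vertex connectivity `κ(G)`. -/
def vertexConnectivity [Fintype V] (G : SimpleGraph V) : ℕ :=
  if G = (⊤ : SimpleGraph V) then Fintype.card V - 1
  else sInf {m | ∃ S : Set V, S.ncard = m ∧ ¬ (G.induce Sᶜ).Connected}

/-- The circulant graph `Circ[n,S]`. -/
def circG (n : ℕ) (S : Set ℕ) : SimpleGraph (ZMod n) :=
  SimpleGraph.fromRel (fun i j => ∃ s ∈ S, j = i + (s : ZMod n))

theorem Forced.apply_eq_zero {F : Type*} [Field F] [Fintype V] {G : SimpleGraph V}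
    {A : Matrix V V F} (hA : SMat F G A) {Z : Set V} {x : V → F} (hx : A.mulVec x = 0)
    (hZ : ∀ z ∈ Z, x z = 0) {v : V} (hv : Forced G Z v) : x v = 0 := by
  induction hv with
  | init v hv => exact hZ v hv
  | force u w _ huw _ hu hother =>
    have hrow : ∑ y, A u y * x y = 0 := congrFun hx u
    rw [Finset.sum_eq_single w] at hrow
    · exact (mul_eq_zero.mp hrow).resolve_left ((hA.2 u w huw.ne).mpr huw)
    · intro y _ hyw
      by_cases hadj : G.Adj u y
      · rw [hother y hadj hyw, mul_zero]
      · by_cases hyu : u = y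
        · rw [← hyu, hu, mul_zero]
        · rw [not_not.mp (mt (hA.2 u y hyu).mp hadj), zero_mul]
    · simp

theorem rank_add_finrank_ker {F : Type*} [Field F] [Fintype V] (A : Matrix V V F) :
    A.rank + Module.finrank F (LinearMap.ker A.mulVecLin) = Fintype.card V := by
  rw [Matrix.rank, LinearMap.finrank_range_add_finrank_ker, Module.finrank_fintype_fun_eq_card]

/-- The nullity of a matrix described by `G` is at most the size of any zero forcing set. -/
theorem IsZeroForcingSet.card_le_rank_add_ncard {F : Type*} [Field F] [Fintype V]
    {G : SimpleGraph V} {A : Matrix V V F} (hA : SMat F G A) {Z : Set V}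
    (hZ : IsZeroForcingSet G Z) : Fintype.card V ≤ A.rank + Z.ncard := by
  have hinj : Function.Injective
      ((LinearMap.funLeft F F (Subtype.val : Z → V)).comp (LinearMap.ker A.mulVecLin).subtype) := by
    rw [← LinearMap.ker_eq_bot, LinearMap.ker_eq_bot']
    intro x hx
    ext v
    refine (hZ v).apply_eq_zero hA (x := x.1) x.2 fun z hz => ?_
    exact congrFun hx ⟨z, hz⟩
  have hle := LinearMap.finrank_le_finrank_of_injective hinj
  rw [Module.finrank_fintype_fun_eq_card, ← Nat.card_eq_fintype_card, Nat.card_coe_set_eq] at hle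
  have := rank_add_finrank_ker A
  omega

theorem rank_le_card_of_rows_determine {F ι : Type*} [Field F] [Fintype V] [Fintype ι]
    (A : Matrix V V F) (f : ι → V)
    (h : ∀ x, (∀ i, A.mulVec x (f i) = 0) → A.mulVec x = 0) : A.rank ≤ Fintype.card ι := by
  have hinj : Function.Injective
      ((LinearMap.funLeft F F f).comp (LinearMap.range A.mulVecLin).subtype) := by
    rw [← LinearMap.ker_eq_bot, LinearMap.ker_eq_bot']
    rintro ⟨_, x, rfl⟩ hx
    exact Subtype.ext (h x (congrFun hx))
  have hle := LinearMap.finrank_le_finrank_of_injective hinj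
  rwa [Module.finrank_fintype_fun_eq_card] at hle

theorem adjMat_mem {F : Type*} [Field F] (G : SimpleGraph V) : SMat F G (adjMat F G) := by
  refine ⟨?_, fun i j _ => ?_⟩
  · ext i j
    simp [adjMat, G.adj_comm]
  · simp [adjMat]

/-- A matrix and a zero forcing set meeting the nullity bound determine all the parameters. -/
theorem parameters_of_rank_add_ncard_le {F : Type*} [Field F] [Fintype V] {G : SimpleGraph V}
    {A : Matrix V V F} (hA : SMat F G A) {Z : Set V} (hZ : IsZeroForcingSet G Z)
    (h : A.rank + Z.ncard ≤ Fintype.card V) :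
    maxNullity F G = Z.ncard ∧ zfn G = Z.ncard ∧ A.rank + Z.ncard = Fintype.card V ∧
      minRank F G = A.rank := by
  have hAZ := hZ.card_le_rank_add_ncard hA
  refine ⟨?_, ?_, by omega, ?_⟩
  · refine IsGreatest.csSup_eq ⟨⟨A, hA, by omega⟩, ?_⟩
    rintro m ⟨B, hB, rfl⟩
    have := hZ.card_le_rank_add_ncard hB
    omega
  · refine IsLeast.csInf_eq ⟨⟨Z, rfl, hZ⟩, ?_⟩
    rintro m ⟨Y, rfl, hY⟩
    have := hY.card_le_rank_add_ncard hA
    omega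
  · refine IsLeast.csInf_eq ⟨⟨A, hA, rfl⟩, ?_⟩
    rintro m ⟨B, hB, rfl⟩
    have := hZ.card_le_rank_add_ncard hB
    omega

theorem natCast_zmod_ne_zero {n a : ℕ} (ha : 0 < a) (han : a < n) : (a : ZMod n) ≠ 0 := by
  rw [Ne, ZMod.natCast_eq_zero_iff]
  exact Nat.not_dvd_of_pos_of_lt ha han

theorem natCast_half_add_self (k : ℕ) : ((4 * k : ℕ) : ZMod (8 * k)) + (4 * k : ℕ) = 0 := by
  rw [← Nat.cast_add, ZMod.natCast_eq_zero_iff]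
  exact ⟨1, by ring⟩

/-- In `Circ[8k, {1, 4k - 1}]`, the vertices `i` and `i + 4k` are twins. -/
theorem circG_half_adj {k : ℕ} (hk : 0 < k) (i j : ZMod (8 * k)) :
    (circG (8 * k) {1, 4 * k - 1}).Adj i j ↔
      j = i + 1 ∨ j = i - 1 ∨ j = i + (4 * k : ℕ) + 1 ∨ j = i + (4 * k : ℕ) - 1 := by
  have hh := natCast_half_add_self k
  have h1 : ((1 : ℕ) : ZMod (8 * k)) ≠ 0 := natCast_zmod_ne_zero one_pos (by omega)
  have h2 : ((4 * k + 1 : ℕ) : ZMod (8 * k)) ≠ 0 := natCast_zmod_ne_zero (by omega) (by omega)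
  have h3 : ((4 * k - 1 : ℕ) : ZMod (8 * k)) ≠ 0 := natCast_zmod_ne_zero (by omega) (by omega)
  rw [Nat.cast_one] at h1
  rw [Nat.cast_add, Nat.cast_one] at h2
  rw [Nat.cast_sub (by omega), Nat.cast_one] at h3
  simp only [circG, SimpleGraph.fromRel_adj, Set.mem_insert_iff, Set.mem_singleton_iff,
    exists_eq_or_imp, exists_eq_left, Nat.cast_one, Nat.cast_sub (show 1 ≤ 4 * k by omega)]
  generalize ((4 * k : ℕ) : ZMod (8 * k)) = c at *
  constructor
  · rintro ⟨-, (h | h) | (h | h)⟩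
    · exact .inl h
    · exact .inr (.inr (.inr (by linear_combination h)))
    · exact .inr (.inl (by linear_combination -h))
    · exact .inr (.inr (.inl (by linear_combination -h - hh)))
  · rintro (h | h | h | h)
    · exact ⟨fun e => h1 (by linear_combination -e - h), .inl (.inl h)⟩
    · exact ⟨fun e => h1 (by linear_combination e + h), .inr (.inl (by linear_combination -h))⟩
    · exact ⟨fun e => h2 (by linear_combination -e - h),
        .inr (.inr (by linear_combination -h - hh))⟩
    · exact ⟨fun e => h3 (by linear_combination -e - h), .inl (.inr (by linear_combination h))⟩

theorem adjMat_circG_half_mulVec {F : Type*} [Field F] {k : ℕ} [NeZero (8 * k)]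
    (x : ZMod (8 * k) → F) (i : ZMod (8 * k)) :
    (adjMat F (circG (8 * k) {1, 4 * k - 1})).mulVec x i =
      (x (i - 1) + x (i - 1 + (4 * k : ℕ))) + (x (i + 1) + x (i + 1 + (4 * k : ℕ))) := by
  have hk : 0 < k := by have := NeZero.ne (8 * k); omega
  have hh := natCast_half_add_self k
  have h1 : ((2 : ℕ) : ZMod (8 * k)) ≠ 0 := natCast_zmod_ne_zero two_pos (by omega)
  have h2 : ((4 * k + 2 : ℕ) : ZMod (8 * k)) ≠ 0 := natCast_zmod_ne_zero (by omega) (by omega)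
  have h3 : ((4 * k : ℕ) : ZMod (8 * k)) ≠ 0 := natCast_zmod_ne_zero (by omega) (by omega)
  rw [Nat.cast_add] at h2
  rw [Nat.cast_two] at h1 h2
  have hN : Finset.univ.filter ((circG (8 * k) {1, 4 * k - 1}).Adj i) =
      {i - 1, i - 1 + ((4 * k : ℕ) : ZMod (8 * k)), i + 1,
        i + 1 + ((4 * k : ℕ) : ZMod (8 * k))} := by
    ext j
    simp only [Finset.mem_filter, Finset.mem_univ, true_and, circG_half_adj hk,
      Finset.mem_insert, Finset.mem_singleton, sub_add_eq_add_sub, add_right_comm i 1]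
    tauto
  have hsum : (adjMat F (circG (8 * k) {1, 4 * k - 1})).mulVec x i =
      ∑ j ∈ Finset.univ.filter ((circG (8 * k) {1, 4 * k - 1}).Adj i), x j := by
    simp [adjMat, Matrix.mulVec, dotProduct, Finset.sum_filter]
  rw [hsum, hN]
  generalize ((4 * k : ℕ) : ZMod (8 * k)) = c at *
  rw [Finset.sum_insert, Finset.sum_insert, Finset.sum_insert, Finset.sum_singleton, ← add_assoc]
  · rw [Finset.mem_singleton]
    exact fun e => h3 (by linear_combination -e)
  · simp only [Finset.mem_insert, Finset.mem_singleton, not_or]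
    exact ⟨fun e => h2 (by linear_combination hh - e), fun e => h1 (by linear_combination -e)⟩
  · simp only [Finset.mem_insert, Finset.mem_singleton, not_or]
    exact ⟨fun e => h3 (by linear_combination -e), fun e => h1 (by linear_combination -e),
      fun e => h2 (by linear_combination -e)⟩

theorem eq_of_add_add_two_eq_zero {R : Type*} [AddCommGroup R] {g : ℕ → R} {m a : ℕ}
    (h : ∀ i < m, g i + g (i + 2) = 0) {q : ℕ} (hq : 4 * q + a < m) :
    g (4 * q + a + 2) = - g a := by
  induction q with
  | zero =>
    have := h a (by omega)
    rw [Nat.mul_zero, Nat.zero_add]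
    exact (neg_eq_of_add_eq_zero_right this).symm
  | succ q ih =>
    have h1 := h (4 * q + a + 2) (by omega)
    have h2 := h (4 * (q + 1) + a) hq
    rw [show 4 * q + a + 2 + 2 = 4 * (q + 1) + a by ring] at h1
    rw [← neg_eq_of_add_eq_zero_right h2, neg_eq_of_add_eq_zero_left h1, ih (by omega)]

theorem rank_adjMat_circG_half_le (F : Type*) [Field F] (k : ℕ) [NeZero (8 * k)] :
    (adjMat F (circG (8 * k) {1, 4 * k - 1})).rank ≤ 4 * k - 2 := by
  have hk : 0 < k := by have := NeZero.ne (8 * k); omega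
  have hh := natCast_half_add_self k
  refine (rank_le_card_of_rows_determine _
    (fun i : Fin (4 * k - 2) => ((i + 1 : ℕ) : ZMod (8 * k))) fun x hx => ?_).trans_eq
    (Fintype.card_fin _)
  simp only [adjMat_circG_half_mulVec] at hx
  set g : ZMod (8 * k) → F := fun i => x i + x (i + (4 * k : ℕ)) with hg
  have hper (i) : g (i + (4 * k : ℕ)) = g i := by
    simp only [hg]
    rw [add_assoc, hh, add_zero, add_comm]
  have hrec : ∀ i < 4 * k - 2, g (i : ℕ) + g ((i + 2 : ℕ) : ZMod (8 * k)) = 0 := by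
    intro i hi
    have := hx ⟨i, hi⟩
    simp only [hg]
    convert this using 5 <;> push_cast <;> ring
  have hlast (a : ℕ) (ha : a < 2) :
      g ((4 * (k - 1) + a + 2 : ℕ) : ZMod (8 * k)) = - g (a : ℕ) :=
    eq_of_add_add_two_eq_zero (g := fun i : ℕ => g i) hrec (by omega)
  have hall : ∀ i < 4 * k, g (i : ℕ) + g ((i + 2 : ℕ) : ZMod (8 * k)) = 0 := by
    intro i hi
    by_cases hlt : i < 4 * k - 2
    · exact hrec i hlt
    · obtain ⟨a, ha, rfl⟩ : ∃ a < 2, i = 4 * (k - 1) + a + 2 := ⟨i - (4 * k - 2), by omega, by omega⟩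
      rw [hlast a ha, show 4 * (k - 1) + a + 2 + 2 = a + 4 * k by omega, Nat.cast_add a, hper,
        neg_add_cancel]
  have hall' (i : ZMod (8 * k)) : g i + g (i + 2) = 0 := by
    by_cases hi : i.val < 4 * k
    · simpa using hall _ hi
    · have := hall (i.val - 4 * k) (by have := i.val_lt; omega)
      rw [← hper, ← hper (_ + _ : ℕ), ← Nat.cast_add, ← Nat.cast_add,
        show i.val - 4 * k + 2 + 4 * k = i.val + 2 by omega,
        show i.val - 4 * k + 4 * k = i.val by omega] at this
      simpa using this
  ext i
  rw [adjMat_circG_half_mulVec]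
  have := hall' (i - 1)
  rwa [show i - 1 + 2 = i + 1 by ring] at this

theorem isZeroForcingSet_circG_half {k : ℕ} (hk : 0 < k) :
    IsZeroForcingSet (circG (8 * k) {1, 4 * k - 1})
      ((fun i : ℕ => (i : ZMod (8 * k))) '' Set.Iio (4 * k + 2)) := by
  have : NeZero (8 * k) := ⟨by omega⟩
  have hh := natCast_half_add_self k
  suffices H : ∀ m < 8 * k, Forced (circG (8 * k) {1, 4 * k - 1})
      ((fun i : ℕ => (i : ZMod (8 * k))) '' Set.Iio (4 * k + 2)) (m : ℕ) by
    intro v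
    simpa using H v.val v.val_lt
  intro m
  induction m using Nat.strong_induction_on with
  | _ m ih =>
    intro hm
    by_cases hlt : m < 4 * k + 2
    · exact .init _ ⟨m, hlt, rfl⟩
    · obtain ⟨d, rfl⟩ : ∃ d, m = d + 2 + 4 * k := ⟨m - (4 * k + 2), by omega⟩
      refine .force ((d + 1 : ℕ) : ZMod (8 * k)) _ (ih _ (by omega) (by omega)) ?_ ?_
      · rw [circG_half_adj hk]
        exact .inr (.inr (.inl (by push_cast; ring)))
      · intro x hx hne
        rw [circG_half_adj hk] at hx
        rcases hx with rfl | rfl | rfl | rfl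
        · convert ih (d + 2) (by omega) (by omega) using 1
          push_cast; ring
        · convert ih d (by omega) (by omega) using 1
          push_cast; ring
        · exact absurd (by push_cast; ring) hne
        · convert ih (d + 4 * k) (by omega) (by omega) using 1
          push_cast; ring

theorem ncard_image_natCast_Iio {n m : ℕ} (h : m ≤ n) :
    ((fun i : ℕ => (i : ZMod n)) '' Set.Iio m).ncard = m := by
  rw [Set.InjOn.ncard_image, ← Finset.coe_Iio, Set.ncard_coe_finset, Nat.card_Iio]
  intro a ha b hb hab
  rw [Set.mem_Iio] at ha hb
  exact ((ZMod.natCast_eq_natCast_iff a b n).mp hab).eq_of_lt_of_lt (by omega) (by omega)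

theorem stmt7 (n : ℕ) (hpos : 0 < n) (hn : 8 ∣ n) :
    haveI : NeZero n := ⟨by omega⟩
    ∀ (F : Type) [Field F],
      maxNullity F (circG n {1, n / 2 - 1}) = zfn (circG n {1, n / 2 - 1}) ∧
      zfn (circG n {1, n / 2 - 1}) = n / 2 + 2 ∧
      (adjMat F (circG n {1, n / 2 - 1})).rank = n - (n / 2 + 2) ∧
      minRank F (circG n {1, n / 2 - 1}) = (adjMat F (circG n {1, n / 2 - 1})).rank := by
  obtain ⟨k, rfl⟩ := hn
  intro F _
  have hk : 0 < k := by omega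
  have : NeZero (8 * k) := ⟨by omega⟩
  rw [show 8 * k / 2 = 4 * k by omega]
  have hcard := ncard_image_natCast_Iio (show 4 * k + 2 ≤ 8 * k by omega)
  have hrank := rank_adjMat_circG_half_le F k
  obtain ⟨hM, hZ, hr, hmr⟩ := parameters_of_rank_add_ncard_le
    (adjMat_mem (F := F) (circG (8 * k) {1, 4 * k - 1})) (isZeroForcingSet_circG_half hk)
    (by rw [hcard, ZMod.card]; omega)
  rw [hcard] at hM hZ hr
  rw [ZMod.card] at hr
  exact ⟨hM.trans hZ.symm, hZ, by omega, hmr⟩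

end Paper
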